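/- Let A be a real 2n×2n symmetric negative semidefinite matrix and let a, b, c, d > 0 be real constants. Let q : ℝ → (ℝ²)ⁿ, v : ℝ → ℝⁿ, θ : ℝ → ℝⁿ, ω : ℝ → ℝⁿ be continuously differentiable and suppose that for every agent i and all t ≥ 0, with hᵢ := (cos θᵢ, sin θᵢ), hᵢ⊥ := (−sin θᵢ, cos θᵢ), and uᵢ := (A q(t))ᵢ, the unicycle dynamics with linear actuator dynamics hold: q̇ᵢ = vᵢ·hᵢ, v̇ᵢ = −a·vᵢ + b·⟨hᵢ, uᵢ⟩, θ̇ᵢ = ωᵢ, and ω̇ᵢ = −c·ωᵢ + d·⟨hᵢ⊥, uᵢ⟩. Then dist(q(t), ker A) → 0 and v(t) → 0 as t → ∞. -/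

import Mathlib

open Filter Matrix

lemma uad_barbalat (F f g f' : ℝ → ℝ) (K L : ℝ)
    (hF : ∀ t, 0 ≤ t → HasDerivAt F (f t + g t) t)
    (hf : ∀ t, 0 ≤ t → HasDerivAt f (f' t) t)
    (hK : ∀ t, 0 ≤ t → |f' t| ≤ K)
    (hL : Tendsto F atTop (nhds L)) (hg : Tendsto g atTop (nhds 0)) :
    Tendsto f atTop (nhds 0) := by
  have hK0 : 0 ≤ K := (abs_nonneg _).trans (hK 0 le_rfl)
  rw [Metric.tendsto_atTop]
  intro ε hε
  obtain ⟨δ, hδ, hKδ⟩ : ∃ δ > 0, K * δ ≤ ε / 4 := by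
    refine ⟨ε / (4 * (K + 1)), by positivity, ?_⟩
    rw [← mul_div_assoc, div_le_div_iff₀ (by positivity) (by positivity)]
    nlinarith
  obtain ⟨N1, h1⟩ := (Metric.tendsto_atTop.1 hL) (ε * δ / 8) (by positivity)
  obtain ⟨N2, h2⟩ := (Metric.tendsto_atTop.1 hg) (ε / 4) (by positivity)
  refine ⟨max 0 (max N1 N2), fun t ht => ?_⟩
  have ht0 : 0 ≤ t := (le_max_left _ _).trans ht
  have ht1 : N1 ≤ t := ((le_max_left _ _).trans (le_max_right _ _)).trans ht
  have ht2 : N2 ≤ t := ((le_max_right _ _).trans (le_max_right _ _)).trans ht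
  obtain ⟨s, hs, hs'⟩ := exists_hasDerivAt_eq_slope F (fun t => f t + g t)
    (show t < t + δ by linarith)
    (fun x hx => (hF x (ht0.trans hx.1)).continuousAt.continuousWithinAt)
    (fun x hx => hF x (ht0.trans hx.1.le))
  have e1 := h1 t ht1
  have e2 := h1 (t + δ) (by linarith)
  have e3 := h2 s (by linarith [hs.1])
  have e4 : ‖f s - f t‖ ≤ K * ‖s - t‖ :=
    (convex_Ici (0:ℝ)).norm_image_sub_le_of_norm_hasDerivWithin_le
      (fun x hx => (hf x hx).hasDerivWithinAt) (fun x hx => hK x hx) ht0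
      (ht0.trans hs.1.le)
  have e5 : K * ‖s - t‖ ≤ K * δ := by
    refine mul_le_mul_of_nonneg_left ?_ hK0
    rw [Real.norm_eq_abs, abs_le]; constructor <;> linarith [hs.1, hs.2]
  have e6 : (f s + g s) * δ = F (t + δ) - F t := by
    rw [hs', add_sub_cancel_left, div_mul_cancel₀ _ hδ.ne']
  have e7 : |f s + g s| * δ ≤ ε / 4 * δ := by
    rw [← abs_of_pos hδ, ← abs_mul, abs_of_pos hδ, e6]
    rw [Real.dist_eq, abs_lt] at e1 e2
    rw [abs_le]; constructor <;> linarith [e1.1, e1.2, e2.1, e2.2]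
  have e8 := le_of_mul_le_mul_right e7 hδ
  rw [Real.norm_eq_abs] at e4
  have e9 := e4.trans (e5.trans hKδ)
  rw [Real.dist_eq, sub_zero, abs_lt] at *
  rw [abs_le] at e8 e9
  constructor <;> linarith [e3.1, e3.2, e8.1, e8.2, e9.1, e9.2]

def UadBd (f : ℝ → ℝ) : Prop := ∃ K, ∀ t, 0 ≤ t → |f t| ≤ K

lemma UadBd.add {f g : ℝ → ℝ} (hf : UadBd f) (hg : UadBd g) : UadBd (fun t => f t + g t) := by
  obtain ⟨K, hK⟩ := hf
  obtain ⟨M, hM⟩ := hg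
  exact ⟨K + M, fun t ht => (abs_add_le _ _).trans (add_le_add (hK t ht) (hM t ht))⟩

lemma UadBd.mul {f g : ℝ → ℝ} (hf : UadBd f) (hg : UadBd g) : UadBd (fun t => f t * g t) := by
  obtain ⟨K, hK⟩ := hf
  obtain ⟨M, hM⟩ := hg
  refine ⟨K * M, fun t ht => ?_⟩
  rw [abs_mul]
  exact mul_le_mul (hK t ht) (hM t ht) (abs_nonneg _) ((abs_nonneg _).trans (hK t ht))

lemma UadBd.const (k : ℝ) : UadBd (fun _ => k) := ⟨|k|, fun _ _ => le_rfl⟩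

lemma UadBd.neg {f : ℝ → ℝ} (hf : UadBd f) : UadBd (fun t => - f t) := by
  obtain ⟨K, hK⟩ := hf
  exact ⟨K, fun t ht => by rw [abs_neg]; exact hK t ht⟩

lemma UadBd.sum {ι : Type*} [Fintype ι] {f : ι → ℝ → ℝ} (hf : ∀ i, UadBd (f i)) :
    UadBd (fun t => ∑ i, f i t) := by
  choose K hK using hf
  exact ⟨∑ i, K i, fun t ht => (Finset.abs_sum_le_sum_abs _ _).trans
    (Finset.sum_le_sum fun i _ => hK i t ht)⟩

lemma uad_tendsto_mul {f g : ℝ → ℝ} (hf : UadBd f) (hg : Tendsto g atTop (nhds 0)) :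
    Tendsto (fun t => f t * g t) atTop (nhds 0) := by
  obtain ⟨K, hK⟩ := hf
  have h : Tendsto (fun t => K * |g t|) atTop (nhds 0) := by
    simpa using (hg.abs).const_mul K
  refine squeeze_zero_norm' ?_ h
  filter_upwards [eventually_ge_atTop (0:ℝ)] with t ht
  rw [norm_mul]
  exact mul_le_mul_of_nonneg_right (hK t ht) (abs_nonneg _)

lemma uad_tendsto_of_sq {f : ℝ → ℝ} (h : Tendsto (fun t => f t * f t) atTop (nhds 0)) :
    Tendsto f atTop (nhds 0) := by
  have h1 := h.sqrt
  simp only [Real.sqrt_mul_self_eq_abs, Real.sqrt_zero] at h1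
  exact (tendsto_zero_iff_abs_tendsto_zero f).2 h1

lemma uad_lin_le (w g : ℝ → ℝ) (c M : ℝ) (hc : 0 < c)
    (hw : ∀ t, 0 ≤ t → HasDerivAt w (-c * w t + g t) t) (hM : ∀ t, 0 ≤ t → g t ≤ M) :
    ∀ t, 0 ≤ t → w t ≤ M / c + |w 0 - M / c| := by
  have hd : ∀ t, 0 ≤ t → HasDerivAt (fun t => Real.exp (c * t) * (w t - M / c))
      (Real.exp (c * t) * (g t - M)) t := by
    intro t ht
    have h1 : HasDerivAt (fun t => Real.exp (c * t)) (Real.exp (c * t) * c) t := by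
      simpa using ((hasDerivAt_id t).const_mul c).exp
    refine (h1.mul ((hw t ht).sub_const (M / c))).congr_deriv ?_
    field_simp
    ring
  have hanti : AntitoneOn (fun t => Real.exp (c * t) * (w t - M / c)) (Set.Ici 0) := by
    refine antitoneOn_of_hasDerivWithinAt_nonpos (convex_Ici 0)
      (fun x hx => (hd x hx).continuousAt.continuousWithinAt)
      (fun x hx => (hd x (interior_subset hx)).hasDerivWithinAt) ?_
    intro x hx
    exact mul_nonpos_of_nonneg_of_nonpos (Real.exp_pos _).le
      (by linarith [hM x (interior_subset hx)])
  intro t ht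
  have h := hanti (Set.mem_Ici.2 le_rfl) (Set.mem_Ici.2 ht) ht
  simp only [mul_zero, Real.exp_zero, one_mul] at h
  have h1 : 1 ≤ Real.exp (c * t) := Real.one_le_exp (by positivity)
  have h2 := le_abs_self (w 0 - M / c)
  have h3 := abs_nonneg (w 0 - M / c)
  by_contra hcon
  push Not at hcon
  nlinarith

lemma uad_lin_bd (w g : ℝ → ℝ) (c : ℝ) (hc : 0 < c)
    (hw : ∀ t, 0 ≤ t → HasDerivAt w (-c * w t + g t) t) (hg : UadBd g) : UadBd w := by
  obtain ⟨M, hM⟩ := hg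
  have h1 := uad_lin_le w g c M hc hw (fun t ht => (abs_le.1 (hM t ht)).2)
  have h2 := uad_lin_le (fun t => - w t) (fun t => - g t) c M hc
    (fun t ht => (hw t ht).neg.congr_deriv (by ring))
    (fun t ht => by linarith [(abs_le.1 (hM t ht)).1])
  refine ⟨max (M / c + |w 0 - M / c|) (M / c + |-w 0 - M / c|), fun t ht => abs_le.2 ⟨?_, ?_⟩⟩
  · have := (h2 t ht).trans (le_max_right (M / c + |w 0 - M / c|) _)
    linarith
  · exact (h1 t ht).trans (le_max_left _ _)

/-- Convergence for one agent once `v → 0` and `u` is bounded. -/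
lemma uad_agent (a b c d : ℝ) (hb : 0 < b) (hc : 0 < c) (hd : 0 < d)
    (v θ ω x y x' y' : ℝ → ℝ)
    (hv : ∀ t, 0 ≤ t → HasDerivAt v
      (-a * v t + b * (Real.cos (θ t) * x t + Real.sin (θ t) * y t)) t)
    (hθ : ∀ t, 0 ≤ t → HasDerivAt θ (ω t) t)
    (hω : ∀ t, 0 ≤ t → HasDerivAt ω
      (-c * ω t + d * (-Real.sin (θ t) * x t + Real.cos (θ t) * y t)) t)
    (hx : ∀ t, 0 ≤ t → HasDerivAt x (x' t) t)
    (hy : ∀ t, 0 ≤ t → HasDerivAt y (y' t) t)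
    (bx : UadBd x) (by' : UadBd y) (bx' : UadBd x') (by'' : UadBd y')
    (hv0 : Tendsto v atTop (nhds 0)) (hx0 : Tendsto x' atTop (nhds 0))
    (hy0 : Tendsto y' atTop (nhds 0)) :
    Tendsto x atTop (nhds 0) ∧ Tendsto y atTop (nhds 0) := by
  have bc : UadBd (fun t => Real.cos (θ t)) := ⟨1, fun t _ => Real.abs_cos_le_one _⟩
  have bs : UadBd (fun t => Real.sin (θ t)) := ⟨1, fun t _ => Real.abs_sin_le_one _⟩
  obtain ⟨p, hp⟩ : ∃ p : ℝ → ℝ, p = fun t => Real.cos (θ t) * x t + Real.sin (θ t) * y t :=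
    ⟨_, rfl⟩
  obtain ⟨r, hr⟩ : ∃ r : ℝ → ℝ, r = fun t => -Real.sin (θ t) * x t + Real.cos (θ t) * y t :=
    ⟨_, rfl⟩
  obtain ⟨g, hg⟩ : ∃ g : ℝ → ℝ, g = fun t => Real.cos (θ t) * x' t + Real.sin (θ t) * y' t :=
    ⟨_, rfl⟩
  obtain ⟨k, hk⟩ : ∃ k : ℝ → ℝ, k = fun t => -Real.sin (θ t) * x' t + Real.cos (θ t) * y' t :=
    ⟨_, rfl⟩
  have bp : UadBd p := by rw [hp]; exact (bc.mul bx).add (bs.mul by')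
  have br : UadBd r := by rw [hr]; exact (bs.neg.mul bx).add (bc.mul by')
  have bg : UadBd g := by rw [hg]; exact (bc.mul bx').add (bs.mul by'')
  have bk : UadBd k := by rw [hk]; exact (bs.neg.mul bx').add (bc.mul by'')
  have g0 : Tendsto g atTop (nhds 0) := by
    rw [hg]; simpa using (uad_tendsto_mul bc hx0).add (uad_tendsto_mul bs hy0)
  have k0 : Tendsto k atTop (nhds 0) := by
    rw [hk]; simpa using (uad_tendsto_mul bs.neg hx0).add (uad_tendsto_mul bc hy0)
  have dv : ∀ t, 0 ≤ t → HasDerivAt v (b * p t + -a * v t) t := fun t ht => by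
    convert hv t ht using 1; rw [hp]; ring
  have dω : ∀ t, 0 ≤ t → HasDerivAt ω (-c * ω t + d * r t) t := fun t ht => by
    convert hω t ht using 1; rw [hr]
  have dp : ∀ t, 0 ≤ t → HasDerivAt p (ω t * r t + g t) t := fun t ht => by
    rw [hp]
    refine (((hθ t ht).cos.mul (hx t ht)).add ((hθ t ht).sin.mul (hy t ht))).congr_deriv ?_
    simp only [hr, hg]; ring
  have dr : ∀ t, 0 ≤ t → HasDerivAt r (-(ω t * p t) + k t) t := fun t ht => by
    rw [hr]
    refine (((hθ t ht).sin.neg.mul (hx t ht)).add ((hθ t ht).cos.mul (hy t ht))).congr_deriv ?_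
    simp only [hp, hk, Pi.neg_apply]; ring
  have bω : UadBd ω := uad_lin_bd ω (fun t => d * r t) c hc dω ((UadBd.const d).mul br)
  have p0 : Tendsto p atTop (nhds 0) := by
    obtain ⟨K, hK⟩ := (UadBd.const b).mul ((bω.mul br).add bg)
    have h := uad_barbalat v (fun t => b * p t) (fun t => -a * v t) _ K 0 dv
      (fun t ht => (dp t ht).const_mul b) hK hv0 (by simpa using hv0.const_mul (-a))
    simpa [hb.ne'] using h.const_mul b⁻¹
  have dr0 : Tendsto (fun t => -(ω t * p t) + k t) atTop (nhds 0) := by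
    simpa using (uad_tendsto_mul bω p0).neg.add k0
  have brd : UadBd (fun t => -(ω t * p t) + k t) := (bω.mul bp).neg.add bk
  have bωd : UadBd (fun t => -c * ω t + d * r t) :=
    ((UadBd.const (-c)).mul bω).add ((UadBd.const d).mul br)
  have dωr : ∀ t, 0 ≤ t → HasDerivAt (fun t => ω t * r t)
      ((-c * ω t + d * r t) * r t + ω t * (-(ω t * p t) + k t)) t :=
    fun t ht => (dω t ht).mul (dr t ht)
  have ωr0 : Tendsto (fun t => ω t * r t) atTop (nhds 0) := by
    obtain ⟨K, hK⟩ := (bωd.mul br).add (bω.mul brd)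
    exact uad_barbalat p (fun t => ω t * r t) g _ K 0 dp dωr hK p0 g0
  have r0 : Tendsto r atTop (nhds 0) := by
    obtain ⟨K, hK⟩ := (UadBd.const d).mul ((brd.mul br).add (br.mul brd))
    have h := uad_barbalat (fun t => ω t * r t) (fun t => d * (r t * r t))
      (fun t => -c * (ω t * r t) + ω t * (-(ω t * p t) + k t)) _ K 0
      (fun t ht => by convert dωr t ht using 1; ring)
      (fun t ht => ((dr t ht).mul (dr t ht)).const_mul d) hK ωr0
      (by simpa using (ωr0.const_mul (-c)).add (uad_tendsto_mul bω dr0))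
    apply uad_tendsto_of_sq
    simpa [hd.ne'] using h.const_mul d⁻¹
  constructor
  · have h := (uad_tendsto_mul bc p0).add (uad_tendsto_mul bs.neg r0)
    rw [add_zero] at h
    refine h.congr fun t => ?_
    simp only [hp, hr]
    linear_combination x t * Real.sin_sq_add_cos_sq (θ t)
  · have h := (uad_tendsto_mul bs p0).add (uad_tendsto_mul bc r0)
    rw [add_zero] at h
    refine h.congr fun t => ?_
    simp only [hp, hr]
    linear_combination y t * Real.sin_sq_add_cos_sq (θ t)

lemma uad_infDist {ι : Type*} [Fintype ι] [DecidableEq ι] (A : Matrix ι ι ℝ)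
    (q : ℝ → EuclideanSpace ℝ ι)
    (h : ∀ j, Tendsto (fun t => A.mulVec (q t) j) atTop (nhds 0)) :
    Tendsto (fun t => Metric.infDist (q t) {x : EuclideanSpace ℝ ι | A.mulVec x = 0})
      atTop (nhds 0) := by
  let T : EuclideanSpace ℝ ι →ₗ[ℝ] (ι → ℝ) :=
    A.mulVecLin ∘ₗ (WithLp.linearEquiv 2 ℝ (ι → ℝ)).toLinearMap
  have hT : ∀ x : EuclideanSpace ℝ ι, T x = A.mulVec x := fun x => rfl
  obtain ⟨S, hS⟩ := LinearMap.exists_rightInverse_of_surjective T.rangeRestrict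
    T.range_rangeRestrict
  have hc : Continuous S := S.continuous_of_finiteDimensional
  have h0 : Tendsto (fun t => T.rangeRestrict (q t)) atTop (nhds 0) := by
    rw [tendsto_subtype_rng]
    exact tendsto_pi_nhds.2 h
  have h1 : Tendsto (fun t => ‖S (T.rangeRestrict (q t))‖) atTop (nhds 0) := by
    have := (hc.tendsto 0).comp h0
    rw [map_zero] at this
    simpa using this.norm
  refine squeeze_zero (fun t => Metric.infDist_nonneg) (fun t => ?_) h1
  have hm : q t - S (T.rangeRestrict (q t)) ∈ {x : EuclideanSpace ℝ ι | A.mulVec x = 0} := by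
    show T (q t - S (T.rangeRestrict (q t))) = 0
    rw [map_sub, sub_eq_zero]
    have := congrArg Subtype.val (LinearMap.congr_fun hS (T.rangeRestrict (q t)))
    exact this.symm
  refine (Metric.infDist_le_dist_of_mem hm).trans ?_
  rw [dist_eq_norm, sub_sub_cancel]

lemma uad_quad {ι : Type*} [Fintype ι] [DecidableEq ι] (A : Matrix ι ι ℝ)
    (hsymm : A.IsSymm) (hnsd : ∀ w : ι → ℝ, w ⬝ᵥ A.mulVec w ≤ 0) (x : ι → ℝ) (j : ι) :
    |A.mulVec x j| ≤ (-(x ⬝ᵥ A.mulVec x) + |A j j|) := by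
  have key : ∀ s : ℝ, x ⬝ᵥ A.mulVec x + 2 * s * A.mulVec x j + s ^ 2 * A j j ≤ 0 := by
    intro s
    have h := hnsd (x + s • Pi.single j 1)
    have e : x ⬝ᵥ A.mulVec (Pi.single j 1) = A.mulVec x j := by
      rw [dotProduct_mulVec, ← mulVec_transpose, hsymm.eq]; simp
    rw [mulVec_add, mulVec_smul, add_dotProduct, dotProduct_add, dotProduct_add,
      dotProduct_smul, smul_dotProduct, smul_dotProduct, dotProduct_smul, e] at h
    simp at h
    linarith
  have h1 := key 1
  have h2 := key (-1)
  have h3 := neg_abs_le (A j j)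
  have h4 := hnsd x
  have h5 := abs_nonneg (A j j)
  rw [abs_le]
  constructor <;> nlinarith


/-- Under the unicycle dynamics with unmodeled linear actuator dynamics
`q̇ᵢ = vᵢ hᵢ`, `v̇ᵢ = −a vᵢ + b ⟨hᵢ, uᵢ⟩`, `θ̇ᵢ = ωᵢ`, `ω̇ᵢ = −c ωᵢ + d ⟨hᵢ⊥, uᵢ⟩`,
with `uᵢ = (A q)ᵢ`, `a, b, c, d > 0` and `A` symmetric negative semidefinite,
`dist (q t, ker A) → 0` and `v t → 0`. -/
theorem unicycle_actuator_dynamics_converges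
    (n : ℕ) (A : Matrix (Fin n × Fin 2) (Fin n × Fin 2) ℝ)
    (hsymm : A.IsSymm) (hnsd : ∀ w : Fin n × Fin 2 → ℝ, w ⬝ᵥ A.mulVec w ≤ 0)
    (a b c d : ℝ) (ha : 0 < a) (hb : 0 < b) (hc : 0 < c) (hd : 0 < d)
    (q : ℝ → EuclideanSpace ℝ (Fin n × Fin 2)) (v : ℝ → Fin n → ℝ)
    (θ : ℝ → Fin n → ℝ) (ω : ℝ → Fin n → ℝ)
    (hq : ContDiff ℝ 1 q) (hv : ContDiff ℝ 1 v) (hθ : ContDiff ℝ 1 θ) (hω : ContDiff ℝ 1 ω)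
    (hdyn : ∀ t : ℝ, 0 ≤ t → ∀ i : Fin n,
      HasDerivAt (fun s => q s (i, 0)) (v t i * Real.cos (θ t i)) t ∧
      HasDerivAt (fun s => q s (i, 1)) (v t i * Real.sin (θ t i)) t ∧
      HasDerivAt (fun s => v s i)
        (-a * v t i + b * (Real.cos (θ t i) * A.mulVec (q t) (i, 0) +
          Real.sin (θ t i) * A.mulVec (q t) (i, 1))) t ∧
      HasDerivAt (fun s => θ s i) (ω t i) t ∧
      HasDerivAt (fun s => ω s i)
        (-c * ω t i + d * (-Real.sin (θ t i) * A.mulVec (q t) (i, 0) +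
          Real.cos (θ t i) * A.mulVec (q t) (i, 1))) t) :
    Tendsto (fun t => Metric.infDist (q t)
        {x : EuclideanSpace ℝ (Fin n × Fin 2) | A.mulVec x = 0}) atTop (nhds 0) ∧
    Tendsto v atTop (nhds 0) := by
  classical
  obtain ⟨w, hw⟩ : ∃ w : ℝ → Fin n × Fin 2 → ℝ, w = fun t j =>
      v t j.1 * (if j.2 = 0 then Real.cos (θ t j.1) else Real.sin (θ t j.1)) := ⟨_, rfl⟩
  have dq : ∀ t, 0 ≤ t → ∀ j, HasDerivAt (fun s => q s j) (w t j) t := by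
    rintro t ht ⟨i, k⟩
    fin_cases k
    · simpa [hw] using (hdyn t ht i).1
    · simpa [hw] using (hdyn t ht i).2.1
  have du : ∀ t, 0 ≤ t → ∀ j, HasDerivAt (fun s => A.mulVec (q s) j) (A.mulVec (w t) j) t := by
    intro t ht j
    simp only [mulVec, dotProduct]
    exact HasDerivAt.fun_sum fun k _ => (dq t ht k).const_mul (A j k)
  obtain ⟨V, hV⟩ : ∃ V : ℝ → ℝ, V = fun t =>
      -(b / 2) * ((q t : Fin n × Fin 2 → ℝ) ⬝ᵥ A.mulVec (q t)) + 1 / 2 * ∑ i, v t i * v t i :=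
    ⟨_, rfl⟩
  obtain ⟨p, hp⟩ : ∃ p : ℝ → Fin n → ℝ, p = fun t i =>
    Real.cos (θ t i) * A.mulVec (q t) (i, 0) + Real.sin (θ t i) * A.mulVec (q t) (i, 1) :=
    ⟨_, rfl⟩
  have dv : ∀ t, 0 ≤ t → ∀ i, HasDerivAt (fun s => v s i) (-a * v t i + b * p t i) t := by
    intro t ht i
    rw [hp]; exact (hdyn t ht i).2.2.1
  have dvv : ∀ t, 0 ≤ t → HasDerivAt (fun s => ∑ i, v s i * v s i)
      (∑ i, ((-a * v t i + b * p t i) * v t i + v t i * (-a * v t i + b * p t i))) t :=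
    fun t ht => HasDerivAt.fun_sum fun i _ => (dv t ht i).mul (dv t ht i)
  have hsw : ∀ t, w t ⬝ᵥ A.mulVec (q t) = ∑ i, v t i * p t i := by
    intro t
    simp only [dotProduct, Fintype.sum_prod_type, Fin.sum_univ_two, hw, hp]
    refine Finset.sum_congr rfl fun i _ => ?_
    simp
    ring
  have dV : ∀ t, 0 ≤ t → HasDerivAt V (-a * ∑ i, v t i * v t i) t := by
    intro t ht
    have h1 : HasDerivAt (fun s => (q s : Fin n × Fin 2 → ℝ) ⬝ᵥ A.mulVec (q s))
        (w t ⬝ᵥ A.mulVec (q t) + (q t : Fin n × Fin 2 → ℝ) ⬝ᵥ A.mulVec (w t)) t := by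
      simp only [dotProduct, ← Finset.sum_add_distrib]
      exact HasDerivAt.fun_sum fun j _ => (dq t ht j).mul (du t ht j)
    have e : (q t : Fin n × Fin 2 → ℝ) ⬝ᵥ A.mulVec (w t) = w t ⬝ᵥ A.mulVec (q t) := by
      rw [dotProduct_mulVec, ← mulVec_transpose, hsymm.eq, dotProduct_comm]
    rw [e, hsw] at h1
    rw [hV]
    refine ((h1.const_mul (-(b / 2))).add ((dvv t ht).const_mul (1 / 2))).congr_deriv ?_
    rw [← Finset.sum_add_distrib]
    simp only [Finset.mul_sum, ← Finset.sum_add_distrib]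
    refine Finset.sum_congr rfl fun i _ => ?_
    ring
  have hVanti : AntitoneOn V (Set.Ici 0) := by
    refine antitoneOn_of_hasDerivWithinAt_nonpos (convex_Ici 0)
      (fun x hx => (dV x hx).continuousAt.continuousWithinAt)
      (fun x hx => (dV x (interior_subset hx)).hasDerivWithinAt) ?_
    intro x hx
    have : 0 ≤ ∑ i, v x i * v x i := Finset.sum_nonneg fun i _ => mul_self_nonneg _
    nlinarith
  have hVle : ∀ t, 0 ≤ t → V t ≤ V 0 := fun t ht =>
    hVanti (Set.mem_Ici.2 le_rfl) (Set.mem_Ici.2 ht) ht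
  have hS0 : ∀ t, 0 ≤ ∑ i, v t i * v t i := fun t =>
    Finset.sum_nonneg fun i _ => mul_self_nonneg _
  have hV0 : ∀ t, 0 ≤ V t := by
    intro t
    have h1 := hnsd (q t)
    have h2 := hS0 t
    simp only [hV]
    nlinarith
  have hVlim : ∃ L, Tendsto V atTop (nhds L) := by
    have hm : Antitone (fun t => V (max 0 t)) := fun s t hst =>
      hVanti (Set.mem_Ici.2 (le_max_left _ _)) (Set.mem_Ici.2 (le_max_left _ _))
        (max_le_max le_rfl hst)
    have h := tendsto_atTop_ciInf hm ⟨0, by rintro _ ⟨t, rfl⟩; exact hV0 _⟩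
    refine ⟨_, h.congr' ?_⟩
    filter_upwards [eventually_ge_atTop (0:ℝ)] with t ht
    rw [max_eq_right ht]
  obtain ⟨L, hL⟩ := hVlim
  have bS : UadBd (fun t => ∑ i, v t i * v t i) := by
    refine ⟨2 * V 0, fun t ht => ?_⟩
    rw [abs_of_nonneg (hS0 t)]
    have h1 := hnsd (q t)
    have h2 := hVle t ht
    simp only [hV] at h2 ⊢
    nlinarith
  have hvS : ∀ t i, v t i * v t i ≤ ∑ i, v t i * v t i := fun t i =>
    Finset.single_le_sum (f := fun i => v t i * v t i) (fun i _ => mul_self_nonneg _)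
      (Finset.mem_univ i)
  have bv : ∀ i, UadBd (fun t => v t i) := by
    intro i
    obtain ⟨K, hK⟩ := bS
    refine ⟨K + 1, fun t ht => ?_⟩
    have h1 := (hvS t i).trans ((le_abs_self _).trans (hK t ht))
    rw [abs_le]
    constructor <;> nlinarith
  have bu : ∀ j, UadBd (fun t => A.mulVec (q t) j) := by
    intro j
    refine ⟨2 / b * V 0 + |A j j|, fun t ht => ?_⟩
    refine (uad_quad A hsymm hnsd (q t) j).trans (add_le_add_left ?_ _)
    have h2 := hVle t ht
    have h3 := hS0 t
    have h4 : b / 2 * -((q t : Fin n × Fin 2 → ℝ) ⬝ᵥ A.mulVec (q t)) ≤ V 0 := by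
      refine le_trans ?_ h2
      simp only [hV]
      linarith
    have h5 := mul_le_mul_of_nonneg_left h4 (show 0 ≤ 2 / b by positivity)
    refine le_trans (le_of_eq ?_) h5
    field_simp
  have bc : ∀ i, UadBd (fun t => Real.cos (θ t i)) := fun i => ⟨1, fun t _ => Real.abs_cos_le_one _⟩
  have bs : ∀ i, UadBd (fun t => Real.sin (θ t i)) := fun i => ⟨1, fun t _ => Real.abs_sin_le_one _⟩
  have bp : ∀ i, UadBd (fun t => p t i) := fun i => by
    rw [hp]; exact ((bc i).mul (bu _)).add ((bs i).mul (bu _))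
  have bh : ∀ j : Fin n × Fin 2, UadBd (fun t =>
      if j.2 = 0 then Real.cos (θ t j.1) else Real.sin (θ t j.1)) := by
    intro j
    split_ifs
    · exact bc _
    · exact bs _
  have bw : ∀ j, UadBd (fun t => w t j) := fun j => by
    rw [hw]; exact (bv j.1).mul (bh j)
  have bdu : ∀ j, UadBd (fun t => A.mulVec (w t) j) := fun j => by
    simp only [mulVec, dotProduct]
    exact UadBd.sum fun k => (UadBd.const (A j k)).mul (bw k)
  have bdv : ∀ i, UadBd (fun t => -a * v t i + b * p t i) := fun i =>
    ((UadBd.const (-a)).mul (bv i)).add ((UadBd.const b).mul (bp i))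
  have S0 : Tendsto (fun t => ∑ i, v t i * v t i) atTop (nhds 0) := by
    obtain ⟨K, hK⟩ := (UadBd.const (-a)).mul
      (UadBd.sum fun i => ((bdv i).mul (bv i)).add ((bv i).mul (bdv i)))
    have h := uad_barbalat V (fun t => -a * ∑ i, v t i * v t i) (fun _ => 0) _ K L
      (fun t ht => by simpa using dV t ht)
      (fun t ht => (dvv t ht).const_mul (-a)) hK hL tendsto_const_nhds
    have h' := h.const_mul (-a)⁻¹
    rw [mul_zero] at h'
    refine h'.congr fun t => ?_
    rw [inv_mul_cancel_left₀ (neg_ne_zero.2 ha.ne')]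
  have v0 : ∀ i, Tendsto (fun t => v t i) atTop (nhds 0) := fun i =>
    uad_tendsto_of_sq (squeeze_zero (fun t => mul_self_nonneg _) (fun t => hvS t i) S0)
  have w0 : ∀ j, Tendsto (fun t => w t j) atTop (nhds 0) := fun j => by
    refine (uad_tendsto_mul (bh j) (v0 j.1)).congr fun t => ?_
    rw [hw, mul_comm]
  have du0 : ∀ j, Tendsto (fun t => A.mulVec (w t) j) atTop (nhds 0) := fun j => by
    simp only [mulVec, dotProduct]
    have := tendsto_finsetSum (Finset.univ : Finset (Fin n × Fin 2))
      fun k _ => (w0 k).const_mul (A j k)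
    simpa using this
  refine ⟨uad_infDist A q ?_, tendsto_pi_nhds.2 v0⟩
  have main : ∀ i, _ := fun i => uad_agent a b c d hb hc hd (fun t => v t i) (fun t => θ t i)
    (fun t => ω t i) (fun t => A.mulVec (q t) (i, 0)) (fun t => A.mulVec (q t) (i, 1))
    (fun t => A.mulVec (w t) (i, 0)) (fun t => A.mulVec (w t) (i, 1))
    (fun t ht => (hdyn t ht i).2.2.1) (fun t ht => (hdyn t ht i).2.2.2.1)
    (fun t ht => (hdyn t ht i).2.2.2.2) (fun t ht => du t ht _) (fun t ht => du t ht _)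
    (bu _) (bu _) (bdu _) (bdu _) (v0 i) (du0 _) (du0 _)
  rintro ⟨i, k⟩
  fin_cases k
  · exact (main i).1
  · exact (main i).2
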